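/- Let a, b, c be complex numbers and σₓ, σᵧ real numbers satisfying Re a + σᵧ > 0, σᵧ < 0, σₓ < 0, Re a + σₓ + σᵧ > 0, Re b − σₓ − σᵧ > 0 and Re c + σₓ > 0. Then, writing x = σₓ + i·s and y = σᵧ + i·t, one has (1/(2π))² ∫_{ℝ²} Γ(a+y)·Γ(−y)·Γ(−x)·Γ(a+x+y)·Γ(b−x−y)·Γ(c+x) ds dt = Γ(a)²·Γ(a+b)·Γ(c)·Γ(a+b+c) / Γ(2a+b+c). -/

import Mathlib

open MeasureTheory

local notation "Γ" => Complex.Gamma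

lemma cpow_pos_eq {x : ℝ} (hx : 0 < x) (z : ℂ) :
    (x : ℂ) ^ z = Complex.exp ((Real.log x : ℂ) * z) := by
  rw [Complex.cpow_def_of_ne_zero (by exact_mod_cast hx.ne'), Complex.ofReal_log hx.le]

lemma beta_image : (fun x : ℝ => x / (1 - x)) '' Set.Ioo 0 1 = Set.Ioi 0 := by
  ext u
  simp only [Set.mem_image, Set.mem_Ioo, Set.mem_Ioi]
  constructor
  · rintro ⟨x, ⟨h0, h1⟩, rfl⟩
    exact div_pos h0 (by linarith)
  · intro hu
    refine ⟨u / (1 + u), ⟨by positivity, ?_⟩, ?_⟩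
    · rw [div_lt_one (by linarith)]; linarith
    · field_simp
      ring

lemma beta_deriv : ∀ x ∈ Set.Ioo (0 : ℝ) 1,
    HasDerivWithinAt (fun x : ℝ => x / (1 - x)) (1 / (1 - x) ^ 2) (Set.Ioo 0 1) x := by
  intro x hx
  have h : (1 : ℝ) - x ≠ 0 := by linarith [hx.2]
  have := ((hasDerivAt_id x).div ((hasDerivAt_id x).const_sub 1) h).hasDerivWithinAt
    (s := Set.Ioo 0 1)
  have e : (1 * (1 - id x) - id x * -1) / (1 - id x) ^ 2 = 1 / (1 - x) ^ 2 := by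
    simp only [id]
    congr 1
    ring
  rw [e] at this
  exact this

lemma beta_inj : Set.InjOn (fun x : ℝ => x / (1 - x)) (Set.Ioo 0 1) := by
  intro x hx y hy h
  have h1 : (1 : ℝ) - x ≠ 0 := by linarith [hx.2]
  have h2 : (1 : ℝ) - y ≠ 0 := by linarith [hy.2]
  simp only at h
  rw [div_eq_div_iff h1 h2] at h
  linarith

lemma beta_integrand (z p : ℂ) {x : ℝ} (hx : x ∈ Set.Ioo (0 : ℝ) 1) :
    |1 / (1 - x) ^ 2| • (((x / (1 - x) : ℝ) : ℂ) ^ (z - 1) * ((1 + x / (1 - x) : ℝ) : ℂ) ^ (-p))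
      = (x : ℂ) ^ (z - 1) * (1 - (x : ℂ)) ^ (p - z - 1) := by
  have h0 := hx.1
  have h1 : 0 < 1 - x := by linarith [hx.2]
  have e1 : 1 + x / (1 - x) = (1 - x)⁻¹ := by field_simp; ring
  have e2 : |1 / (1 - x) ^ 2| = Real.exp (-2 * Real.log (1 - x)) := by
    rw [abs_of_pos (by positivity), show -2 * Real.log (1 - x) = -(Real.log (1-x) + Real.log (1-x)) by ring,
      Real.exp_neg, Real.exp_add, Real.exp_log h1, one_div, sq]
  have e3 : (1 - (x : ℂ)) = ((1 - x : ℝ) : ℂ) := by push_cast; rfl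
  rw [e1, e2, e3, cpow_pos_eq (div_pos h0 h1), cpow_pos_eq (inv_pos.2 h1), cpow_pos_eq h0,
    cpow_pos_eq h1, Real.log_inv, Real.log_div h0.ne' h1.ne', Complex.real_smul,
    Complex.ofReal_exp, ← Complex.exp_add, ← Complex.exp_add, ← Complex.exp_add]
  congr 1
  push_cast
  ring

lemma beta_integrable (z p : ℂ) (hz : 0 < z.re) (hp : z.re < p.re) :
    IntegrableOn (fun u : ℝ => (u : ℂ) ^ (z - 1) * ((1 + u : ℝ) : ℂ) ^ (-p)) (Set.Ioi 0) := by
  rw [← beta_image, integrableOn_image_iff_integrableOn_abs_deriv_smul measurableSet_Ioo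
    beta_deriv beta_inj, integrableOn_congr_fun (fun x hx => beta_integrand z p hx)
    measurableSet_Ioo]
  have := Complex.betaIntegral_convergent hz (v := p - z) (by simpa using hp)
  rw [intervalIntegrable_iff_integrableOn_Ioo_of_le zero_le_one] at this
  exact this

lemma beta_integral (z p : ℂ) (hz : 0 < z.re) (hp : z.re < p.re) :
    Γ z * Γ (p - z) =
      Γ p * ∫ u in Set.Ioi (0 : ℝ), (u : ℂ) ^ (z - 1) * ((1 + u : ℝ) : ℂ) ^ (-p) := by
  rw [← beta_image, integral_image_eq_integral_abs_deriv_smul measurableSet_Ioo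
    beta_deriv beta_inj, setIntegral_congr_fun measurableSet_Ioo
    (fun x hx => beta_integrand z p hx),
    Complex.Gamma_mul_Gamma_eq_betaIntegral hz (t := p - z) (by simpa using hp)]
  rw [Complex.betaIntegral, intervalIntegral.integral_of_le zero_le_one,
    integral_Ioc_eq_integral_Ioo]
  congr 2
  ring

lemma norm_gamma_le (s : ℂ) (hs : 0 < s.re) : ‖Γ s‖ ≤ Real.Gamma s.re := by
  rw [Complex.Gamma_eq_integral hs, Complex.GammaIntegral, Real.Gamma_eq_integral hs]
  refine (norm_integral_le_integral_norm _).trans (le_of_eq ?_)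
  refine setIntegral_congr_fun measurableSet_Ioi (fun x hx => ?_)
  simp only [norm_mul]
  rw [Complex.norm_cpow_eq_rpow_re_of_pos hx, Complex.norm_real, Real.norm_of_nonneg (Real.exp_pos _).le]
  simp

lemma norm_gamma_decay (r : ℝ) (hr : 0 < r) :
    ∃ C : ℝ, ∀ s : ℂ, s.re = r → ‖Γ s‖ ≤ C * (1 + s.im ^ 2)⁻¹ := by
  refine ⟨Real.Gamma r + Real.Gamma (r + 2), fun s hs => ?_⟩
  have hs0 : s ≠ 0 := by rintro rfl; simp at hs; linarith
  have hs1 : s + 1 ≠ 0 := by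
    intro h
    have := congrArg Complex.re h
    simp at this; linarith
  have h2 : Γ (s + 2) = (s + 1) * (s * Γ s) := by
    rw [← Complex.Gamma_add_one s hs0, ← Complex.Gamma_add_one _ hs1]
    congr 1; ring
  have b1 := norm_gamma_le s (by linarith)
  have b2 := norm_gamma_le (s + 2) (by simp; linarith)
  rw [h2, norm_mul, norm_mul] at b2
  have i1 : |s.im| ≤ ‖s‖ := Complex.abs_im_le_norm s
  have i2 : |s.im| ≤ ‖s + 1‖ := by simpa using Complex.abs_im_le_norm (s + 1)
  have i3 : s.im ^ 2 ≤ ‖s + 1‖ * ‖s‖ := by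
    rw [← sq_abs, sq]; gcongr
  have e : (s + 2).re = r + 2 := by simp [hs]
  rw [e] at b2
  rw [hs] at b1
  rw [← div_eq_mul_inv, le_div_iff₀ (by positivity)]
  nlinarith [mul_le_mul_of_nonneg_right i3 (norm_nonneg (Γ s))]

lemma gamma_comp_cont {X : Type*} [TopologicalSpace X] {f : X → ℂ} (hf : Continuous f)
    (h : ∀ x, 0 < (f x).re) : Continuous fun x => Γ (f x) := by
  rw [continuous_iff_continuousAt]
  intro x
  have : ContinuousAt Γ (f x) := by
    apply (Complex.differentiableAt_Gamma _ ?_).continuousAt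
    intro m hm
    have h1 := h x
    rw [hm] at h1
    simp at h1
    have : (0 : ℝ) ≤ m := m.cast_nonneg
    linarith
  exact ContinuousAt.comp (f := f) this hf.continuousAt

lemma gamma_pair_integrable (a : ℂ) (ρ : ℝ) (h0 : 0 < ρ) (h1 : ρ < a.re) :
    Integrable fun t : ℝ => Γ ((ρ : ℂ) + t * Complex.I) * Γ (a - ((ρ : ℂ) + t * Complex.I)) := by
  obtain ⟨C, hC⟩ := norm_gamma_decay ρ h0
  refine Integrable.mono' (g := fun t : ℝ => C * (1 + t ^ 2)⁻¹ * Real.Gamma (a.re - ρ))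
    ((integrable_inv_one_add_sq.const_mul C).mul_const _) ?_ ?_
  · refine Continuous.aestronglyMeasurable ?_
    exact (gamma_comp_cont (by fun_prop) (by simp [h0])).mul
      (gamma_comp_cont (by fun_prop) (by simp [h1]))
  · refine Filter.Eventually.of_forall fun t => ?_
    rw [norm_mul]
    have b1 := hC ((ρ : ℂ) + t * Complex.I) (by simp)
    have b2 := norm_gamma_le (a - ((ρ : ℂ) + t * Complex.I)) (by simp [h1])
    simp only [Complex.sub_re, Complex.add_re, Complex.ofReal_re, Complex.mul_re, Complex.I_re,
      mul_zero, Complex.ofReal_im, Complex.I_im, mul_one, sub_self, add_zero, Complex.add_im,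
      Complex.mul_im, zero_add] at b1 b2
    exact mul_le_mul b1 b2 (norm_nonneg _) ((norm_nonneg _).trans b1)

lemma inv_formula (a : ℂ) (ρ : ℝ) (h0 : 0 < ρ) (h1 : ρ < a.re) {u : ℝ} (hu : 0 < u) :
    (1 / (2 * (Real.pi : ℂ))) * ∫ t : ℝ, (u : ℂ) ^ (-((ρ : ℂ) + t * Complex.I)) *
      (Γ ((ρ : ℂ) + t * Complex.I) * Γ (a - ((ρ : ℂ) + t * Complex.I))) =
      Γ a * ((1 + u : ℝ) : ℂ) ^ (-a) := by
  have ha : Γ a ≠ 0 := Complex.Gamma_ne_zero_of_re_pos (h0.trans h1)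
  set f : ℝ → ℂ := fun u => ((1 + u : ℝ) : ℂ) ^ (-a) with hf
  have hm : ∀ t : ℝ, mellin f ((ρ : ℂ) + t * Complex.I) = (Γ a)⁻¹ *
      (Γ ((ρ : ℂ) + t * Complex.I) * Γ (a - ((ρ : ℂ) + t * Complex.I))) := by
    intro t
    rw [beta_integral _ a (by simp [h0]) (by simp [h1]), inv_mul_cancel_left₀ ha]
    simp [mellin, hf]
  have key := mellinInv_mellin_eq ρ f hu
    (by
      have := beta_integrable ρ a (by simp [h0]) (by simp [h1])
      simpa [MellinConvergent, hf] using this)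
    (by
      unfold Complex.VerticalIntegrable
      simp_rw [hm]
      exact (gamma_pair_integrable a ρ h0 h1).const_mul _)
    (by
      apply ContinuousAt.cpow (by fun_prop) (by fun_prop)
      left
      simp; linarith)
  rw [mellinInv] at key
  simp_rw [hm, smul_eq_mul, mul_left_comm _ (Γ a)⁻¹] at key
  rw [integral_const_mul, Complex.real_smul] at key
  push_cast at key
  rw [hf] at key
  simp only at key
  push_cast at key ⊢
  rw [← key, mul_left_comm, ← mul_assoc (Γ a), mul_inv_cancel₀ ha, one_mul]

lemma barnes_aux (a β δ : ℂ) (ρ : ℝ) (h0 : 0 < ρ) (h1 : ρ < a.re) (h2 : ρ < β.re)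
    (h3 : 0 < δ.re + ρ) :
    (1 / (2 * (Real.pi : ℂ))) * ∫ t : ℝ,
      (Γ ((ρ : ℂ) + t * Complex.I) * Γ (a - ((ρ : ℂ) + t * Complex.I))) *
      (Γ (β - ((ρ : ℂ) + t * Complex.I)) * Γ (δ + ((ρ : ℂ) + t * Complex.I))) =
      Γ a * Γ (a + δ) * Γ β * Γ (β + δ) / Γ (a + β + δ) := by
  set H : ℝ → ℂ := fun t =>
    Γ ((ρ : ℂ) + t * Complex.I) * Γ (a - ((ρ : ℂ) + t * Complex.I)) with hH
  have hHi : Integrable H := gamma_pair_integrable a ρ h0 h1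
  let K : ℝ → ℝ → ℂ := fun t u =>
    H t * ((u : ℂ) ^ (β - ((ρ : ℂ) + t * Complex.I) - 1) * ((1 + u : ℝ) : ℂ) ^ (-(β + δ)))
  have hb := beta_integrable (β - ρ) (β + δ) (by simp [h2]) (by simp; linarith)
  have hK : Integrable (Function.uncurry K) (volume.prod (volume.restrict (Set.Ioi (0 : ℝ)))) := by
    refine Integrable.mono (hHi.mul_prod hb) ?_ ?_
    · have hHm : AEStronglyMeasurable (fun p : ℝ × ℝ => H p.1)
          (volume.prod (volume.restrict (Set.Ioi (0 : ℝ)))) := hHi.aestronglyMeasurable.comp_fst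
      refine hHm.mul (Measurable.aestronglyMeasurable ?_)
      fun_prop
    · have : ∀ᵐ p : ℝ × ℝ ∂(volume.prod (volume.restrict (Set.Ioi (0 : ℝ)))), 0 < p.2 := by
        have h : ∀ᵐ u : ℝ ∂(volume.restrict (Set.Ioi (0 : ℝ))), 0 < u :=
          ae_restrict_mem measurableSet_Ioi
        exact Measure.quasiMeasurePreserving_snd.ae h
      filter_upwards [this] with p hp
      simp only [Function.uncurry, K, norm_mul]
      rw [Complex.norm_cpow_eq_rpow_re_of_pos hp, Complex.norm_cpow_eq_rpow_re_of_pos hp]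
      simp
  have step1 : ∀ t : ℝ, H t * (Γ (β - ((ρ : ℂ) + t * Complex.I)) *
      Γ (δ + ((ρ : ℂ) + t * Complex.I))) = Γ (β + δ) * ∫ u in Set.Ioi (0 : ℝ), K t u := by
    intro t
    have := beta_integral (β - ((ρ : ℂ) + t * Complex.I)) (β + δ) (by simp [h2])
      (by simp; linarith)
    rw [show β + δ - (β - ((ρ : ℂ) + t * Complex.I)) = δ + ((ρ : ℂ) + t * Complex.I) by ring]
      at this
    rw [this]
    simp only [K]
    rw [integral_const_mul]
    ring
  refine (congrArg (fun f : ℝ → ℂ => (1 / (2 * (Real.pi : ℂ))) * ∫ t, f t)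
    (funext step1)).trans ?_
  rw [integral_const_mul, integral_integral_swap hK]
  have step2 : ∀ u ∈ Set.Ioi (0 : ℝ), (∫ t, K t u) = (2 * Real.pi : ℂ) * Γ a *
      ((u : ℂ) ^ (β - 1) * ((1 + u : ℝ) : ℂ) ^ (-(a + β + δ))) := by
    intro u hu
    have hu' : (0 : ℝ) < u := hu
    have hu0 : (u : ℂ) ≠ 0 := by exact_mod_cast hu'.ne'
    have hu1 : ((1 + u : ℝ) : ℂ) ≠ 0 := by exact_mod_cast (by linarith : 1 + u ≠ 0)
    have e : ∀ t, K t u = ((u : ℂ) ^ (β - 1) * ((1 + u : ℝ) : ℂ) ^ (-(β + δ))) *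
        ((u : ℂ) ^ (-((ρ : ℂ) + t * Complex.I)) * H t) := by
      intro t
      simp only [K]
      rw [show β - ((ρ : ℂ) + t * Complex.I) - 1 = (β - 1) + (-((ρ : ℂ) + t * Complex.I)) by ring,
        Complex.cpow_add _ _ hu0]
      ring
    simp_rw [e]
    rw [integral_const_mul]
    have := inv_formula a ρ h0 h1 hu'
    rw [show -(a + β + δ) = -(β + δ) + -a by ring, Complex.cpow_add _ _ hu1]
    have hpi : (Real.pi : ℂ) ≠ 0 := by exact_mod_cast Real.pi_ne_zero
    rw [one_div, inv_mul_eq_iff_eq_mul₀ (by simp [hpi])] at this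
    rw [this]
    ring
  rw [setIntegral_congr_fun measurableSet_Ioi step2, integral_const_mul]
  have fin := beta_integral β (a + β + δ) (by linarith) (by simp; linarith)
  rw [show a + β + δ - β = a + δ by ring] at fin
  have hne : Γ (a + β + δ) ≠ 0 := Complex.Gamma_ne_zero_of_re_pos (by simp; linarith)
  have hpi : (Real.pi : ℂ) ≠ 0 := by exact_mod_cast Real.pi_ne_zero
  rw [eq_div_iff hne]
  linear_combination (-(Γ a * Γ (β + δ))) * fin + (Γ (β + δ) * Γ a * (∫ u in Set.Ioi (0 : ℝ), (u : ℂ) ^ (β - 1) * ((1 + u : ℝ) : ℂ) ^ (-(a + β + δ))) * Γ (a + β + δ)) * (mul_inv_cancel₀ hpi)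

lemma barnes (a β δ : ℂ) (σ : ℝ) (h0 : σ < 0) (h1 : 0 < a.re + σ) (h2 : 0 < β.re + σ)
    (h3 : 0 < δ.re - σ) :
    ∫ t : ℝ, Γ (a + ((σ : ℂ) + t * Complex.I)) * Γ (-((σ : ℂ) + t * Complex.I)) *
      Γ (β + ((σ : ℂ) + t * Complex.I)) * Γ (δ - ((σ : ℂ) + t * Complex.I)) =
      2 * Real.pi * (Γ a * Γ (a + δ) * Γ β * Γ (β + δ) / Γ (a + β + δ)) := by
  have hpi : (Real.pi : ℂ) ≠ 0 := by exact_mod_cast Real.pi_ne_zero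
  have := barnes_aux a β δ (-σ) (by linarith) (by linarith) (by linarith) (by linarith)
  rw [one_div, inv_mul_eq_iff_eq_mul₀ (by simp [hpi])] at this
  rw [← this, ← integral_neg_eq_self]
  congr 1
  ext t
  push_cast
  rw [show a + ((σ : ℂ) + -t * Complex.I) = a - (-σ + t * Complex.I) by ring,
    show -((σ : ℂ) + -t * Complex.I) = (-σ + t * Complex.I) by ring,
    show β + ((σ : ℂ) + -t * Complex.I) = β - (-σ + t * Complex.I) by ring,
    show δ - ((σ : ℂ) + -t * Complex.I) = δ + (-σ + t * Complex.I) by ring]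
  ring

/-- Two-fold Mellin–Barnes integral in which two distinct pinching configurations produce
the same family of poles, yielding the double-pole factor `Γ(a)²` in the closed form
(the paper's eq. (C.22)).  Here `x = σₓ + i s` and `y = σᵧ + i t`. -/
theorem two_fold_mellin_barnes_double_pole
    (a b c : ℂ) (σx σy : ℝ)
    (h₁ : 0 < a.re + σy) (h₂ : σy < 0) (h₃ : σx < 0)
    (h₄ : 0 < a.re + σx + σy) (h₅ : 0 < b.re - σx - σy) (h₆ : 0 < c.re + σx) :
    (1 / (2 * (Real.pi : ℂ))) ^ 2 *
      (∫ q : ℝ × ℝ,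
        let x : ℂ := (σx : ℂ) + (q.1 : ℂ) * Complex.I
        let y : ℂ := (σy : ℂ) + (q.2 : ℂ) * Complex.I
        Γ (a + y) * Γ (-y) * Γ (-x) * Γ (a + x + y) * Γ (b - x - y) * Γ (c + x)) =
      Γ a ^ 2 * Γ (a + b) * Γ c * Γ (a + b + c) / Γ (2 * a + b + c) := by
  simp only
  have hpi : (Real.pi : ℂ) ≠ 0 := by exact_mod_cast Real.pi_ne_zero
  have hint : Integrable (fun q : ℝ × ℝ =>
      Γ (a + ((σy : ℂ) + (q.2 : ℂ) * Complex.I)) * Γ (-((σy : ℂ) + (q.2 : ℂ) * Complex.I)) *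
      Γ (-((σx : ℂ) + (q.1 : ℂ) * Complex.I)) *
      Γ (a + ((σx : ℂ) + (q.1 : ℂ) * Complex.I) + ((σy : ℂ) + (q.2 : ℂ) * Complex.I)) *
      Γ (b - ((σx : ℂ) + (q.1 : ℂ) * Complex.I) - ((σy : ℂ) + (q.2 : ℂ) * Complex.I)) *
      Γ (c + ((σx : ℂ) + (q.1 : ℂ) * Complex.I))) (volume.prod volume) := by
    obtain ⟨Cx, hCx⟩ := norm_gamma_decay (-σx) (by linarith)
    obtain ⟨Cy, hCy⟩ := norm_gamma_decay (-σy) (by linarith)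
    have hg : Integrable (fun q : ℝ × ℝ =>
        Real.Gamma (a.re + σy) * Real.Gamma (a.re + σx + σy) * Real.Gamma (b.re - σx - σy) *
        Real.Gamma (c.re + σx) * ((Cx * (1 + q.1 ^ 2)⁻¹) * (Cy * (1 + q.2 ^ 2)⁻¹)))
        (volume.prod volume) :=
      ((integrable_inv_one_add_sq.const_mul Cx).mul_prod
        (integrable_inv_one_add_sq.const_mul Cy)).const_mul _
    refine Integrable.mono' hg ?_ ?_
    · refine Continuous.aestronglyMeasurable ?_
      refine ((((Continuous.mul ?_ ?_).mul ?_).mul ?_).mul ?_).mul ?_ <;>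
      · refine gamma_comp_cont (by fun_prop) (fun q => ?_)
        simp
        linarith
    · refine Filter.Eventually.of_forall fun q => ?_
      have b1 := norm_gamma_le (a + ((σy : ℂ) + (q.2 : ℂ) * Complex.I)) (by simp; linarith)
      have b2 := hCy (-((σy : ℂ) + (q.2 : ℂ) * Complex.I)) (by simp)
      have b3 := hCx (-((σx : ℂ) + (q.1 : ℂ) * Complex.I)) (by simp)
      have b4 := norm_gamma_le (a + ((σx : ℂ) + (q.1 : ℂ) * Complex.I) +
        ((σy : ℂ) + (q.2 : ℂ) * Complex.I)) (by simp; linarith)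
      have b5 := norm_gamma_le (b - ((σx : ℂ) + (q.1 : ℂ) * Complex.I) -
        ((σy : ℂ) + (q.2 : ℂ) * Complex.I)) (by simp; linarith)
      have b6 := norm_gamma_le (c + ((σx : ℂ) + (q.1 : ℂ) * Complex.I)) (by simp; linarith)
      simp only [Complex.sub_re, Complex.add_re, Complex.ofReal_re, Complex.mul_re, Complex.I_re,
        mul_zero, Complex.ofReal_im, Complex.I_im, mul_one, sub_self, add_zero, Complex.add_im,
        Complex.mul_im, zero_add, Complex.neg_im, neg_sq] at b1 b2 b3 b4 b5 b6
      simp only [norm_mul]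
      have n1 := (norm_nonneg _).trans b1
      have n2 := (norm_nonneg _).trans b2
      have n3 := (norm_nonneg _).trans b3
      have n4 := (norm_nonneg _).trans b4
      have n5 := (norm_nonneg _).trans b5
      have n6 := (norm_nonneg _).trans b6
      refine (mul_le_mul (mul_le_mul (mul_le_mul (mul_le_mul (mul_le_mul b1 b2 (norm_nonneg _) n1)
        b3 (norm_nonneg _) (by positivity)) b4 (norm_nonneg _) (by positivity)) b5
        (norm_nonneg _) (by positivity)) b6 (norm_nonneg _) (by positivity)).trans (le_of_eq ?_)
      ring
  rw [Measure.volume_eq_prod, integral_prod _ hint]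
  have inner : ∀ s : ℝ, (∫ t : ℝ,
      Γ (a + ((σy : ℂ) + (t : ℂ) * Complex.I)) * Γ (-((σy : ℂ) + (t : ℂ) * Complex.I)) *
      Γ (-((σx : ℂ) + (s : ℂ) * Complex.I)) *
      Γ (a + ((σx : ℂ) + (s : ℂ) * Complex.I) + ((σy : ℂ) + (t : ℂ) * Complex.I)) *
      Γ (b - ((σx : ℂ) + (s : ℂ) * Complex.I) - ((σy : ℂ) + (t : ℂ) * Complex.I)) *
      Γ (c + ((σx : ℂ) + (s : ℂ) * Complex.I))) =
      (2 * Real.pi * (Γ a * Γ (a + b) / Γ (2 * a + b))) *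
      (Γ (a + ((σx : ℂ) + (s : ℂ) * Complex.I)) * Γ (-((σx : ℂ) + (s : ℂ) * Complex.I)) *
      Γ (c + ((σx : ℂ) + (s : ℂ) * Complex.I)) *
      Γ (a + b - ((σx : ℂ) + (s : ℂ) * Complex.I))) := by
    intro s
    set x : ℂ := (σx : ℂ) + (s : ℂ) * Complex.I with hx
    have hxr : x.re = σx := by simp [hx]
    have B := barnes a (a + x) (b - x) σy h₂ h₁ (by simp [hxr]; linarith) (by simp [hxr]; linarith)
    rw [show a + (b - x) = a + b - x by ring, show a + x + (b - x) = a + b by ring,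
      show a + (a + x) + (b - x) = 2 * a + b by ring] at B
    calc _ = ∫ t : ℝ, (Γ (-x) * Γ (c + x)) * (Γ (a + ((σy : ℂ) + t * Complex.I)) *
          Γ (-((σy : ℂ) + t * Complex.I)) * Γ (a + x + ((σy : ℂ) + t * Complex.I)) *
          Γ (b - x - ((σy : ℂ) + t * Complex.I))) := by
            congr 1; ext t; ring
      _ = _ := by
            rw [integral_const_mul, B]; ring
  simp_rw [inner]
  rw [integral_const_mul, barnes a c (a + b) σx h₃ (by linarith) (by linarith)
    (by simp; linarith)]
  have hne : Γ (2 * a + b) ≠ 0 := Complex.Gamma_ne_zero_of_re_pos (by simp; linarith)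
  rw [show a + (a + b) = 2 * a + b by ring, show c + (a + b) = a + b + c by ring,
    show a + c + (a + b) = 2 * a + b + c by ring]
  have hne2 : Γ (2 * a + b + c) ≠ 0 := Complex.Gamma_ne_zero_of_re_pos (by simp; linarith)
  field_simp
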